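/- arXiv:1302.6058 — 3 statements merged into one kernel-verified Lean document; each statement's English description precedes it below -/
import Mathlib

section
/- For every U > 0, the function G is continuous at U; that is, G : (0,∞) → ℝ defined by G(U) = ∫_ℝ min{0, c₀ − ℓ(U,V)} · (2πσ²U)^{−1/2} · exp(−V²/(2σ²U)) dV is continuous on (0,∞). -/
open MeasureTheory Real Filter Set

/-- κ = σ²/σx² -/
noncomputable def kap (σ σx : ℝ) : ℝ := σ ^ 2 / σx ^ 2

/-- The marginalized likelihood ratio L(U,V). -/
noncomputable def Lf (σ σx μx U V : ℝ) : ℝ :=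
  σ / σx / Real.sqrt (U + kap σ σx) *
    Real.exp ((V + μx * kap σ σx) ^ 2 / (2 * σ ^ 2 * (U + kap σ σx)) - μx ^ 2 / (2 * σx ^ 2))

/-- The optimum estimate m(U,V). -/
noncomputable def mf (σ σx μx U V : ℝ) : ℝ :=
  (V + μx * kap σ σx) / (U + kap σ σx)

/-- ℓ(U,V) = L(U,V)(c₁ + c_e m(U,V)²). -/
noncomputable def ellf (σ σx μx c₁ ce U V : ℝ) : ℝ :=
  Lf σ σx μx U V * (c₁ + ce * (mf σ σx μx U V) ^ 2)

/-- G(U) = ∫ min{0, c₀ − ℓ(U,V)} N(0, σ²U)(dV). -/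
noncomputable def Gf (σ σx μx c₀ c₁ ce U : ℝ) : ℝ :=
  ∫ V : ℝ, min 0 (c₀ - ellf σ σx μx c₁ ce U V) *
    ((Real.sqrt (2 * Real.pi * σ ^ 2 * U))⁻¹ * Real.exp (-V ^ 2 / (2 * σ ^ 2 * U)))

theorem kap_pos {σ σx : ℝ} (hσ : 0 < σ) (hσx : 0 < σx) : 0 < kap σ σx := by
  unfold kap; positivity

theorem ellf_nonneg {σ σx c₁ ce U : ℝ} (μx V : ℝ) (hσ : 0 < σ) (hσx : 0 < σx)
    (hc₁ : 0 ≤ c₁) (hce : 0 ≤ ce) : 0 ≤ ellf σ σx μx c₁ ce U V := by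
  unfold ellf Lf; positivity

theorem abs_min_zero_sub_le {c x : ℝ} (hc : 0 ≤ c) (hx : 0 ≤ x) : |min 0 (c - x)| ≤ x := by
  rw [abs_of_nonpos (min_le_left _ _), neg_le]
  exact le_min (by linarith) (by linarith)

/-- Completing the square: the likelihood ratio times the prior Gaussian weight is again a
Gaussian weight, centred at `μx * U`. -/
theorem exponent_eq {σ σx U : ℝ} (μx V : ℝ) (hσ : 0 < σ) (hσx : 0 < σx) (hU : 0 < U) :
    (V + μx * kap σ σx) ^ 2 / (2 * σ ^ 2 * (U + kap σ σx)) - μx ^ 2 / (2 * σx ^ 2)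
      + -V ^ 2 / (2 * σ ^ 2 * U)
      = -(kap σ σx / (2 * σ ^ 2 * (U * (U + kap σ σx))) * (V - μx * U) ^ 2) := by
  have hκ := kap_pos hσ hσx
  have h : μx ^ 2 / (2 * σx ^ 2) = μx ^ 2 * kap σ σx / (2 * σ ^ 2) := by
    unfold kap; field_simp
  rw [h]
  generalize kap σ σx = κ at *
  have : U + κ ≠ 0 := by positivity
  field_simp
  ring

theorem exponent_le {σ σx U b : ℝ} (μx V : ℝ) (hσ : 0 < σ) (hσx : 0 < σx) (hU : 0 < U)
    (hUb : U ≤ b) :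
    (V + μx * kap σ σx) ^ 2 / (2 * σ ^ 2 * (U + kap σ σx)) - μx ^ 2 / (2 * σx ^ 2)
      + -V ^ 2 / (2 * σ ^ 2 * U)
      ≤ -(kap σ σx / (4 * σ ^ 2 * (b * (b + kap σ σx)))) * V ^ 2
        + kap σ σx * μx ^ 2 / (2 * σ ^ 2) := by
  have hκ := kap_pos hσ hσx
  have hb : 0 < b := hU.trans_le hUb
  rw [exponent_eq μx V hσ hσx hU]
  generalize kap σ σx = κ at *
  have h1 : κ / (2 * σ ^ 2 * (U * (U + κ))) * (V ^ 2 / 2 - μx ^ 2 * U ^ 2)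
      ≤ κ / (2 * σ ^ 2 * (U * (U + κ))) * (V - μx * U) ^ 2 := by
    gcongr
    nlinarith [sq_nonneg (V - 2 * (μx * U))]
  have h2 : κ / (4 * σ ^ 2 * (b * (b + κ))) * V ^ 2
      ≤ κ / (4 * σ ^ 2 * (U * (U + κ))) * V ^ 2 := by
    gcongr
  have h3 : κ / (2 * σ ^ 2 * (U * (U + κ))) * (μx ^ 2 * U ^ 2) ≤ κ * μx ^ 2 / (2 * σ ^ 2) := by
    have : κ / (2 * σ ^ 2 * (U * (U + κ))) * (μx ^ 2 * U ^ 2)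
        = κ * μx ^ 2 / (2 * σ ^ 2) * (U / (U + κ)) := by
      have : U + κ ≠ 0 := by positivity
      field_simp
    rw [this]
    exact mul_le_of_le_one_right (by positivity) ((div_le_one (by positivity)).2 (by linarith))
  have h4 : κ / (2 * σ ^ 2 * (U * (U + κ))) * (V ^ 2 / 2)
      = κ / (4 * σ ^ 2 * (U * (U + κ))) * V ^ 2 := by
    have : U + κ ≠ 0 := by positivity
    field_simp
    ring
  rw [mul_sub, h4] at h1
  linarith

theorem mf_sq_le {σ σx U : ℝ} (μx V : ℝ) (hσ : 0 < σ) (hσx : 0 < σx) (hU : 0 < U) :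
    (mf σ σx μx U V) ^ 2 ≤ 2 * (V ^ 2 + (μx * kap σ σx) ^ 2) / (kap σ σx) ^ 2 := by
  have hκ := kap_pos hσ hσx
  unfold mf
  rw [div_pow]
  gcongr
  · exact add_sq_le
  · linarith

/-- A Gaussian-times-quadratic bound for the integrand of `Gf`, uniform for `U ∈ [a, b]`. -/
theorem norm_integrand_le {σ σx c₀ c₁ ce U a b : ℝ} (μx V : ℝ) (hσ : 0 < σ) (hσx : 0 < σx)
    (hc₀ : 0 ≤ c₀) (hc₁ : 0 ≤ c₁) (hce : 0 ≤ ce) (ha : 0 < a) (haU : a ≤ U) (hUb : U ≤ b) :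
    ‖min 0 (c₀ - ellf σ σx μx c₁ ce U V) *
      ((√(2 * π * σ ^ 2 * U))⁻¹ * exp (-V ^ 2 / (2 * σ ^ 2 * U)))‖
    ≤ σ / σx / √(kap σ σx) * (√(2 * π * σ ^ 2 * a))⁻¹ *
      (c₁ + ce * (2 * (V ^ 2 + (μx * kap σ σx) ^ 2) / (kap σ σx) ^ 2)) *
      exp (-(kap σ σx / (4 * σ ^ 2 * (b * (b + kap σ σx)))) * V ^ 2
        + kap σ σx * μx ^ 2 / (2 * σ ^ 2)) := by
  have hκ := kap_pos hσ hσx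
  have hU : 0 < U := ha.trans_le haU
  have hD : 0 ≤ (√(2 * π * σ ^ 2 * U))⁻¹ * exp (-V ^ 2 / (2 * σ ^ 2 * U)) := by positivity
  rw [norm_mul, Real.norm_eq_abs, Real.norm_eq_abs, abs_of_nonneg hD]
  refine (mul_le_mul_of_nonneg_right
    (abs_min_zero_sub_le hc₀ (ellf_nonneg μx V hσ hσx hc₁ hce)) hD).trans ?_
  have heq : ellf σ σx μx c₁ ce U V *
      ((√(2 * π * σ ^ 2 * U))⁻¹ * exp (-V ^ 2 / (2 * σ ^ 2 * U)))
      = σ / σx / √(U + kap σ σx) * (√(2 * π * σ ^ 2 * U))⁻¹ * (c₁ + ce * (mf σ σx μx U V) ^ 2) *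
        exp ((V + μx * kap σ σx) ^ 2 / (2 * σ ^ 2 * (U + kap σ σx)) - μx ^ 2 / (2 * σx ^ 2)
          + -V ^ 2 / (2 * σ ^ 2 * U)) := by
    rw [exp_add]; unfold ellf Lf; ring
  rw [heq]
  gcongr ?_ / √?_ * (√(_ * ?_))⁻¹ * (_ + _ * ?_) * exp ?_
  · linarith
  · linarith
  · exact mf_sq_le μx V hσ hσx hU
  · exact exponent_le μx V hσ hσx hU hUb

theorem integrable_quadratic_mul_exp_neg_mul_sq {A : ℝ} (hA : 0 < A) (C p q r s B : ℝ) :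
    Integrable fun V : ℝ ↦ C * (p + q * (2 * (V ^ 2 + r) / s)) * exp (-A * V ^ 2 + B) := by
  have h0 := (integrable_exp_neg_mul_sq hA).const_mul (C * exp B * (p + q * (2 * r / s)))
  have h2 : Integrable fun V : ℝ ↦ V ^ 2 * exp (-A * V ^ 2) := by
    simpa using integrable_rpow_mul_exp_neg_mul_sq hA (s := 2) (by norm_num)
  refine (h0.add (h2.const_mul (C * exp B * q * 2 / s))).congr (ae_of_all _ fun V ↦ ?_)
  simp only [Pi.add_apply, exp_add]
  ring

theorem continuousAt_integrand {σ σx U : ℝ} (μx c₀ c₁ ce V : ℝ) (hσ : 0 < σ) (hσx : 0 < σx)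
    (hU : 0 < U) :
    ContinuousAt (fun U ↦ min 0 (c₀ - ellf σ σx μx c₁ ce U V) *
      ((√(2 * π * σ ^ 2 * U))⁻¹ * exp (-V ^ 2 / (2 * σ ^ 2 * U)))) U := by
  have hκ := kap_pos hσ hσx
  have h1 : √(U + kap σ σx) ≠ 0 := by positivity
  have h2 : U + kap σ σx ≠ 0 := by positivity
  have h3 : 2 * σ ^ 2 * (U + kap σ σx) ≠ 0 := by positivity
  have h4 : √(2 * π * σ ^ 2 * U) ≠ 0 := by positivity
  have h5 : 2 * σ ^ 2 * U ≠ 0 := by positivity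
  unfold ellf Lf mf
  fun_prop (disch := assumption)

/-- G is continuous on (0,∞). -/
theorem G_continuousOn (σ σx μx c₀ c₁ ce : ℝ) (hσ : 0 < σ) (hσx : 0 < σx)
    (hc₀ : 0 ≤ c₀) (hc₁ : 0 ≤ c₁) (hce : 0 ≤ ce) :
    ContinuousOn (Gf σ σx μx c₀ c₁ ce) (Set.Ioi (0 : ℝ)) := by
  intro U₀ hU₀
  have hU₀ : 0 < U₀ := hU₀
  have hκ := kap_pos hσ hσx
  have hnhds : Icc (U₀ / 2) (2 * U₀) ∈ nhds U₀ := Icc_mem_nhds (by linarith) (by linarith)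
  refine ContinuousAt.continuousWithinAt ?_
  unfold Gf
  refine continuousAt_of_dominated (Eventually.of_forall fun U ↦ ?_)
    (mem_of_superset hnhds fun U hU ↦ ae_of_all _ fun V ↦
      norm_integrand_le μx V hσ hσx hc₀ hc₁ hce (half_pos hU₀) hU.1 hU.2)
    (integrable_quadratic_mul_exp_neg_mul_sq (by positivity) _ _ _ _ _ _)
    (ae_of_all _ fun V ↦ continuousAt_integrand μx c₀ c₁ ce V hσ hσx hU₀)
  refine Continuous.aestronglyMeasurable ?_
  unfold ellf Lf mf
  fun_prop
end

section
/- Assume c₀, c₁, c_e > 0 and let g(U) denote, for each U ≥ 0, the unique real solution g of c₀ = √(κ/(U+κ)) · exp(g/(2σ²(U+κ)) − μ_x²κ/(2σ²)) · (c₁ + c_e·g/(U+κ)²). Then g(U) = Θ(U log U) as U → ∞: there exist positive constants a₁, a₂ and U₀ > 0 such that for all U ≥ U₀, a₁·U·log U ≤ g(U) ≤ a₂·U·log U. -/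
open MeasureTheory Real Filter Set

/-- The right-hand side of the threshold equation (3.1), as a function of g. -/
noncomputable def Ff (σ σx μx c₁ ce U g : ℝ) : ℝ :=
  Real.sqrt (kap σ σx / (U + kap σ σx)) *
    Real.exp (g / (2 * σ ^ 2 * (U + kap σ σx)) - μx ^ 2 * kap σ σx / (2 * σ ^ 2)) *
    (c₁ + ce * g / (U + kap σ σx) ^ 2)

/-- With `V = U + κ` and `x = g / (2σ²V)`, the right-hand side of the threshold equation is
`K * exp (x - log V / 2) * (c₁ + 2 * ce * σ ^ 2 * x / V)` for a constant `K > 0`. -/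
theorem exists_Ff_eq_mul_exp (σ σx μx c₁ ce : ℝ) (hσ : 0 < σ) (hσx : 0 < σx) :
    ∃ K : ℝ, 0 < K ∧ ∀ U x : ℝ, 0 ≤ U →
      Ff σ σx μx c₁ ce U (2 * σ ^ 2 * (U + kap σ σx) * x) =
        K * Real.exp (x - Real.log (U + kap σ σx) / 2) *
          (c₁ + 2 * ce * σ ^ 2 * x / (U + kap σ σx)) := by
  have hk : 0 < kap σ σx := by unfold kap; positivity
  refine ⟨Real.sqrt (kap σ σx) * Real.exp (-(μx ^ 2 * kap σ σx / (2 * σ ^ 2))),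
    by positivity, fun U x hU => ?_⟩
  unfold Ff
  generalize kap σ σx = k at *
  have hV : 0 < U + k := by positivity
  have hsqrt : Real.sqrt (U + k) = Real.exp (Real.log (U + k) / 2) := by
    rw [Real.exp_half, Real.exp_log hV]
  have harg : 2 * σ ^ 2 * (U + k) * x / (2 * σ ^ 2 * (U + k)) = x := by field_simp
  have hfac : ce * (2 * σ ^ 2 * (U + k) * x) / (U + k) ^ 2 =
      2 * ce * σ ^ 2 * x / (U + k) := by field_simp
  rw [harg, hfac, Real.sqrt_div hk.le, hsqrt, sub_eq_add_neg x, sub_eq_add_neg x,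
    Real.exp_add, Real.exp_add, Real.exp_neg (Real.log (U + k) / 2)]
  ring

/-- A solution `x` of `c₀ = K * exp (x - log V / 2) * (c₁ + b * x / V)` lies between
`log V / 4` and `log V` once `log V` is large. -/
theorem log_bounds_of_eq_mul_exp {K c₀ c₁ b V x : ℝ} (hK : 0 < K) (hc₀ : 0 < c₀)
    (hc₁ : 0 < c₁) (hb : 0 < b) (hV : 1 ≤ V)
    (h₁ : c₀ / (K * c₁) ≤ Real.log V / 4) (h₂ : K * (c₁ + b) / c₀ ≤ Real.log V / 4)
    (h : c₀ = K * Real.exp (x - Real.log V / 2) * (c₁ + b * x / V)) :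
    Real.log V / 4 ≤ x ∧ x ≤ Real.log V := by
  have hV0 : 0 < V := by positivity
  have hL : 0 ≤ Real.log V := Real.log_nonneg hV
  rw [div_le_iff₀ (by positivity)] at h₁ h₂
  constructor
  · by_contra! hx
    have hxV : x / V ≤ 1 := by
      rw [div_le_one hV0]
      linarith [Real.log_le_sub_one_of_pos hV0]
    have hfac : c₁ + b * x / V ≤ c₁ + b := by
      rw [mul_div_assoc]
      nlinarith
    have hexp : Real.exp (x - Real.log V / 2) ≤ Real.exp (-(Real.log V / 4)) :=
      Real.exp_le_exp.2 (by linarith)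
    have hle : c₀ ≤ Real.exp (-(Real.log V / 4)) * (K * (c₁ + b)) := by
      calc c₀ = K * Real.exp (x - Real.log V / 2) * (c₁ + b * x / V) := h
        _ ≤ K * Real.exp (x - Real.log V / 2) * (c₁ + b) := by gcongr
        _ ≤ K * Real.exp (-(Real.log V / 4)) * (c₁ + b) := by gcongr
        _ = _ := by ring
    rw [Real.exp_neg, ← div_eq_inv_mul, le_div_iff₀ (Real.exp_pos _)] at hle
    nlinarith [Real.add_one_le_exp (Real.log V / 4)]
  · by_contra! hx
    have hx0 : 0 ≤ x := hL.trans hx.le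
    have hexp : Real.log V / 4 + 1 ≤ Real.exp (x - Real.log V / 2) := by
      linarith [Real.add_one_le_exp (x - Real.log V / 2)]
    have hge : K * (Real.log V / 4 + 1) * c₁ ≤ c₀ := by
      rw [h]
      gcongr
      exact le_add_of_nonneg_right (by positivity)
    nlinarith [mul_pos hK hc₁]

/-- the solution g(U) of the threshold equation satisfies
g(U) = Θ(U log U) as U → ∞. -/
theorem threshold_solution_order (σ σx μx c₀ c₁ ce : ℝ)
    (hσ : 0 < σ) (hσx : 0 < σx) (hc₀ : 0 < c₀) (hc₁ : 0 < c₁) (hce : 0 < ce)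
    (g : ℝ → ℝ) (hg : ∀ U : ℝ, 0 ≤ U → c₀ = Ff σ σx μx c₁ ce U (g U)) :
    ∃ a₁ a₂ U₀ : ℝ, 0 < a₁ ∧ 0 < a₂ ∧ 0 < U₀ ∧
      ∀ U : ℝ, U₀ ≤ U →
        a₁ * U * Real.log U ≤ g U ∧ g U ≤ a₂ * U * Real.log U := by
  have hk : 0 < kap σ σx := by unfold kap; positivity
  obtain ⟨K, hK, hF⟩ := exists_Ff_eq_mul_exp σ σx μx c₁ ce hσ hσx
  generalize kap σ σx = k at *
  have hM₁ : 0 < c₀ / (K * c₁) := by positivity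
  have hM₂ : 0 < K * (c₁ + 2 * ce * σ ^ 2) / c₀ := by positivity
  set M := 4 * (c₀ / (K * c₁) + K * (c₁ + 2 * ce * σ ^ 2) / c₀) with hM
  refine ⟨σ ^ 2 / 2, 8 * σ ^ 2, Real.exp M + k + 2, by positivity, by positivity,
    by positivity, fun U hU => ?_⟩
  have hexpM := Real.exp_pos M
  have hU0 : 0 < U := by linarith
  have hV0 : 0 < U + k := by linarith
  have hMV : M ≤ Real.log (U + k) := (Real.le_log_iff_exp_le hV0).2 (by linarith)
  have hUV : Real.log U ≤ Real.log (U + k) := Real.log_le_log hU0 (by linarith)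
  have hVU : Real.log (U + k) ≤ 2 * Real.log U := by
    have := Real.log_le_log hV0 (show U + k ≤ U ^ 2 by nlinarith)
    rwa [Real.log_pow, Nat.cast_ofNat] at this
  have hlogU : 0 ≤ Real.log U := Real.log_nonneg (by linarith)
  obtain ⟨x, hx⟩ : ∃ x, g U = 2 * σ ^ 2 * (U + k) * x :=
    ⟨g U / (2 * σ ^ 2 * (U + k)), by field_simp⟩
  have heq := hg U hU0.le
  rw [hx, hF U x hU0.le] at heq
  obtain ⟨hlow, hupp⟩ := log_bounds_of_eq_mul_exp hK hc₀ hc₁ (by positivity) (by linarith)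
    (by linarith) (by linarith) heq
  rw [hx]
  constructor
  · calc σ ^ 2 / 2 * U * Real.log U = 2 * σ ^ 2 * U * (Real.log U / 4) := by ring
      _ ≤ 2 * σ ^ 2 * (U + k) * x := by
        gcongr
        · linarith
        · linarith
  · calc 2 * σ ^ 2 * (U + k) * x ≤ 2 * σ ^ 2 * (2 * U) * (2 * Real.log U) := by
          gcongr
          · linarith
          · linarith
          · linarith
      _ = 8 * σ ^ 2 * U * Real.log U := by ring
end

section
/- For every U > 0 and every measurable set D ⊆ ℝ, ∫_ℝ [c₀·1_D(V) + ℓ(U,V)·1_{ℝ∖D}(V)] · (2πσ²U)^{−1/2}·exp(−V²/(2σ²U)) dV ≥ G(U) + c₁ + c_e·(μ_x² + σ_x²·U/(U+κ)), with equality when D = {V ∈ ℝ : c₀ ≤ ℓ(U,V)}. -/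
open MeasureTheory Real Filter Set

open ProbabilityTheory in
/-- The second moment of an affine function of a Gaussian variable, written against its density. -/
theorem integrable_and_integral_gaussianPDFReal_mul_affine_sq (m : ℝ) {v : NNReal} (hv : v ≠ 0)
    (a b : ℝ) :
    Integrable (fun x => gaussianPDFReal m v x * (a * (x - m) + b) ^ 2) ∧
      ∫ x, gaussianPDFReal m v x * (a * (x - m) + b) ^ 2 = a ^ 2 * v + b ^ 2 := by
  have hid : Integrable (fun x : ℝ => x) (gaussianReal m v) :=
    (memLp_id_gaussianReal' 1 (by simp)).integrable le_rfl
  have hL1 : Integrable (fun x : ℝ => x - m) (gaussianReal m v) := hid.sub (integrable_const m)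
  have hmean : ∫ x, (x - m) ∂gaussianReal m v = 0 := by
    rw [integral_sub hid (integrable_const m)]
    simp [integral_id_gaussianReal]
  have hL2 : Integrable (fun x : ℝ => (x - m) ^ 2) (gaussianReal m v) :=
    ((memLp_id_gaussianReal' 2 (by simp)).sub (memLp_const m)).integrable_sq
  have hvar : ∫ x, (x - m) ^ 2 ∂gaussianReal m v = v := by
    have h := variance_fun_id_gaussianReal (μ := m) (v := v)
    rwa [variance_eq_integral aemeasurable_id', integral_id_gaussianReal] at h
  have hexp : (fun x : ℝ => (a * (x - m) + b) ^ 2) =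
      fun x => a ^ 2 * (x - m) ^ 2 + (2 * a * b * (x - m) + b ^ 2) := by
    funext x; ring
  have hlin : Integrable (fun x : ℝ => 2 * a * b * (x - m) + b ^ 2) (gaussianReal m v) :=
    (hL1.const_mul _).add (integrable_const _)
  have hint : Integrable (fun x : ℝ => (a * (x - m) + b) ^ 2) (gaussianReal m v) := by
    rw [hexp]
    exact (hL2.const_mul _).add hlin
  constructor
  · rw [gaussianReal_of_var_ne_zero m hv, integrable_withDensity_iff_integrable_smul'
      (measurable_gaussianPDF m v) (ae_of_all _ fun _ => gaussianPDF_lt_top)] at hint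
    simpa only [toReal_gaussianPDF, smul_eq_mul] using hint
  · have h := integral_gaussianReal_eq_integral_smul (μ := m) hv
      (f := fun x : ℝ => (a * (x - m) + b) ^ 2)
    simp only [smul_eq_mul] at h
    rw [← h, hexp, integral_add (hL2.const_mul _) hlin,
      integral_add (hL1.const_mul _) (integrable_const _), integral_const_mul, integral_const_mul,
      hmean, hvar]
    simp

open ProbabilityTheory in
/-- The likelihood ratio turns the noise density into the marginal density under the signal. -/
theorem Lf_mul_gaussianPDFReal {σ σx : ℝ} (μx : ℝ) (hσ : 0 < σ) (hσx : 0 < σx) {U : ℝ} (hU : 0 < U)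
    (v : NNReal) (hv : (v : ℝ) = σx ^ 2 * U * (U + kap σ σx)) (V : ℝ) :
    Lf σ σx μx U V *
        ((Real.sqrt (2 * Real.pi * σ ^ 2 * U))⁻¹ * Real.exp (-V ^ 2 / (2 * σ ^ 2 * U))) =
      gaussianPDFReal (μx * U) v V := by
  have hk := kap_pos hσ hσx
  have hs : σ ^ 2 = kap σ σx * σx ^ 2 := by unfold kap; field_simp
  have hroot : σ / σx = Real.sqrt (kap σ σx) := by
    rw [kap, ← div_pow, Real.sqrt_sq (by positivity)]
  rw [gaussianPDFReal, Lf, hroot, hv, hs]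
  generalize kap σ σx = k at *
  rw [mul_mul_mul_comm, ← Real.exp_add, ← Real.sqrt_div hk.le, ← Real.sqrt_inv,
    ← Real.sqrt_mul (by positivity), ← Real.sqrt_inv]
  congr 2
  · field_simp
  · field_simp
    ring

open ProbabilityTheory in
theorem integrable_and_integral_ellf_mul {σ σx : ℝ} (μx c₁ ce : ℝ) (hσ : 0 < σ) (hσx : 0 < σx)
    {U : ℝ} (hU : 0 < U) :
    Integrable (fun V => ellf σ σx μx c₁ ce U V *
        ((Real.sqrt (2 * Real.pi * σ ^ 2 * U))⁻¹ * Real.exp (-V ^ 2 / (2 * σ ^ 2 * U)))) ∧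
      ∫ V, ellf σ σx μx c₁ ce U V *
        ((Real.sqrt (2 * Real.pi * σ ^ 2 * U))⁻¹ * Real.exp (-V ^ 2 / (2 * σ ^ 2 * U))) =
      c₁ + ce * (μx ^ 2 + σx ^ 2 * U / (U + kap σ σx)) := by
  have hk := kap_pos hσ hσx
  have hpos : 0 < σx ^ 2 * U * (U + kap σ σx) := by positivity
  obtain ⟨v, hv⟩ : ∃ v : NNReal, (v : ℝ) = σx ^ 2 * U * (U + kap σ σx) := ⟨⟨_, hpos.le⟩, rfl⟩
  have hv0 : v ≠ 0 := by
    rintro rfl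
    simp [← hv] at hpos
  obtain ⟨hint, hval⟩ := integrable_and_integral_gaussianPDFReal_mul_affine_sq (μx * U) hv0
    (U + kap σ σx)⁻¹ μx
  have hfun : (fun V => ellf σ σx μx c₁ ce U V *
        ((Real.sqrt (2 * Real.pi * σ ^ 2 * U))⁻¹ * Real.exp (-V ^ 2 / (2 * σ ^ 2 * U)))) =
      fun V => c₁ * gaussianPDFReal (μx * U) v V +
        ce * (gaussianPDFReal (μx * U) v V * ((U + kap σ σx)⁻¹ * (V - μx * U) + μx) ^ 2) := by
    funext V
    have hm : mf σ σx μx U V = (U + kap σ σx)⁻¹ * (V - μx * U) + μx := by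
      unfold mf; field_simp; ring
    rw [ellf, hm, mul_right_comm, Lf_mul_gaussianPDFReal μx hσ hσx hU v hv]
    ring
  have hpdf := (integrable_gaussianPDFReal (μx * U) v).const_mul c₁
  rw [hfun]
  refine ⟨hpdf.add (hint.const_mul ce), ?_⟩
  rw [integral_add hpdf (hint.const_mul ce), integral_const_mul, integral_const_mul, hval,
    integral_gaussianPDFReal_eq_one _ hv0, hv]
  field_simp
  ring

/-- The density of the centred Gaussian law of variance `σ² U` is integrable. -/
theorem integrable_centered_gaussian_density {σ U : ℝ} (hU : 0 < U) :
    Integrable (fun V : ℝ =>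
      (Real.sqrt (2 * Real.pi * σ ^ 2 * U))⁻¹ * Real.exp (-V ^ 2 / (2 * σ ^ 2 * U))) := by
  have h := ProbabilityTheory.integrable_gaussianPDFReal 0 ⟨σ ^ 2 * U, by positivity⟩
  refine h.congr (ae_of_all _ fun V => ?_)
  simp only [ProbabilityTheory.gaussianPDFReal, sub_zero, mul_assoc]
  rfl

/-- for every measurable D ⊆ ℝ,
∫ (c₀ 1_D + ℓ(U,·) 1_{Dᶜ}) dN(0,σ²U) ≥ G(U) + c₁ + c_e(μx² + σx² U/(U+κ)),
with equality when D = {V : c₀ ≤ ℓ(U,V)}. -/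
theorem optimal_decision_region (σ σx μx c₀ c₁ ce : ℝ) (hσ : 0 < σ) (hσx : 0 < σx)
    (hc₀ : 0 ≤ c₀) (hc₁ : 0 ≤ c₁) (hce : 0 ≤ ce) :
    ∀ U : ℝ, 0 < U → ∀ D : Set ℝ, MeasurableSet D →
      (Gf σ σx μx c₀ c₁ ce U + c₁ + ce * (μx ^ 2 + σx ^ 2 * U / (U + kap σ σx)) ≤
        ∫ V : ℝ, (Set.indicator D (fun _ => c₀) V +
            Set.indicator Dᶜ (fun W => ellf σ σx μx c₁ ce U W) V) *
          ((Real.sqrt (2 * Real.pi * σ ^ 2 * U))⁻¹ *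
            Real.exp (-V ^ 2 / (2 * σ ^ 2 * U)))) ∧
      (D = {V : ℝ | c₀ ≤ ellf σ σx μx c₁ ce U V} →
        (∫ V : ℝ, (Set.indicator D (fun _ => c₀) V +
            Set.indicator Dᶜ (fun W => ellf σ σx μx c₁ ce U W) V) *
          ((Real.sqrt (2 * Real.pi * σ ^ 2 * U))⁻¹ *
            Real.exp (-V ^ 2 / (2 * σ ^ 2 * U)))) =
          Gf σ σx μx c₀ c₁ ce U + c₁ +
            ce * (μx ^ 2 + σx ^ 2 * U / (U + kap σ σx))) := by
  intro U hU D hD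
  obtain ⟨hH, hHval⟩ := integrable_and_integral_ellf_mul μx c₁ ce hσ hσx hU
  have hd := integrable_centered_gaussian_density (σ := σ) hU
  have hd0 : ∀ V : ℝ, 0 ≤ (Real.sqrt (2 * Real.pi * σ ^ 2 * U))⁻¹ *
      Real.exp (-V ^ 2 / (2 * σ ^ 2 * U)) := fun V => by positivity
  rw [add_assoc, ← hHval, Gf]
  set d : ℝ → ℝ := fun V => (Real.sqrt (2 * Real.pi * σ ^ 2 * U))⁻¹ *
      Real.exp (-V ^ 2 / (2 * σ ^ 2 * U))
  set l : ℝ → ℝ := fun V => ellf σ σx μx c₁ ce U V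
  change Integrable (fun V => l V * d V) at hH
  change ∀ V, 0 ≤ d V at hd0
  change (∫ V, min 0 (c₀ - l V) * d V) + (∫ V, l V * d V) ≤
      (∫ V, (D.indicator (fun _ => c₀) V + Dᶜ.indicator l V) * d V) ∧
    (D = {V | c₀ ≤ l V} →
      (∫ V, (D.indicator (fun _ => c₀) V + Dᶜ.indicator l V) * d V) =
        (∫ V, min 0 (c₀ - l V) * d V) + ∫ V, l V * d V)
  have hF : Integrable (fun V => min 0 (c₀ - l V) * d V) := by
    refine ((integrable_zero ℝ ℝ volume).inf ((hd.const_mul c₀).sub hH)).congr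
      (ae_of_all _ fun V => ?_)
    simp [min_mul_of_nonneg _ _ (hd0 V), sub_mul]
  have hI : Integrable (fun V => (D.indicator (fun _ => c₀) V + Dᶜ.indicator l V) * d V) := by
    refine (((hd.const_mul c₀).indicator hD).add (hH.indicator hD.compl)).congr
      (ae_of_all _ fun V => ?_)
    by_cases hV : V ∈ D <;> simp [hV]
  rw [← integral_add hF hH]
  constructor
  · refine integral_mono (hF.add hH) hI fun V => ?_
    simp only [← add_mul]
    refine mul_le_mul_of_nonneg_right ?_ (hd0 V)
    by_cases hV : V ∈ D
    · have := min_le_right 0 (c₀ - l V)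
      simp [hV]; linarith
    · simp [hV]
  · rintro rfl
    refine integral_congr_ae (ae_of_all _ fun V => ?_)
    simp only [← add_mul]
    congr 1
    by_cases hV : c₀ ≤ l V
    · simp [hV]
    · simp [hV, (not_le.mp hV).le]
end
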